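/- Let V be a finite type, let s, d ∈ V with s ≠ d, let N ≥ 2, and let v_1, …, v_N ∈ V be pairwise distinct. Let f : Set V → ℝ and f_k : Set V → ℝ for k = 1, …, N−1 all be submodular, and assume f S = f_k S for every k ∈ {1, …, N−1} and every S ⊆ V with ¬(v_k ∈ S ∧ v_{k+1} ∉ S). Assume that the minimum of f over all s–d cuts is strictly less than the minimum of f_1 over all s–d cuts, and that the minimum of f over all s–d cuts differs from the minimum of f_k over all s–d cuts for every k ∈ {1, …, N−1}. Then every s–d cut S* attaining the minimum of f satisfies v_1 ∈ S* and v_j ∉ S* for every j ∈ {2, …, N}. -/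

import Mathlib

/-- A function `g : Set V → ℝ` is submodular if
`g S1 + g S2 ≥ g (S1 ∪ S2) + g (S1 ∩ S2)` for all `S1, S2 ⊆ V`. -/
def Submodular {V : Type*} (g : Set V → ℝ) : Prop :=
  ∀ S1 S2 : Set V, g (S1 ∪ S2) + g (S1 ∩ S2) ≤ g S1 + g S2

/-- The minimum of `f` over all `s`–`d` cuts, i.e. over all `S ⊆ V` with `s ∈ S` and
`d ∉ S`.  For `V` finite and `s ≠ d` this collection is finite and nonempty, so the
infimum below is attained and is the minimum. -/
noncomputable def cutMin {V : Type*} (s d : V) (f : Set V → ℝ) : ℝ :=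
  sInf (f '' {S : Set V | s ∈ S ∧ d ∉ S})

theorem cutMin_le {V : Type*} [Finite V] {s d : V} (f : Set V → ℝ) {S : Set V}
    (hs : s ∈ S) (hd : d ∉ S) : cutMin s d f ≤ f S :=
  csInf_le (Set.toFinite _).bddBelow ⟨S, ⟨hs, hd⟩, rfl⟩

theorem exists_eq_cutMin {V : Type*} [Finite V] {s d : V} (hsd : s ≠ d) (f : Set V → ℝ) :
    ∃ S : Set V, s ∈ S ∧ d ∉ S ∧ f S = cutMin s d f := by
  have hne : (f '' {S : Set V | s ∈ S ∧ d ∉ S}).Nonempty := ⟨_, {s}, ⟨rfl, hsd.symm⟩, rfl⟩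
  obtain ⟨S, ⟨hs, hd⟩, h⟩ := hne.csInf_mem (Set.toFinite _)
  exact ⟨S, hs, hd, h⟩

/-- Suppose `f` and the submodular `g` agree on every set which the link `(a, b)` does not leave,
and their min-cuts differ. A minimizing cut of `f` that misses `a` also misses `b`. -/
theorem notMem_of_cutMin_ne {V : Type*} [Finite V] {s d : V} (hsd : s ≠ d) {a b : V}
    {f g : Set V → ℝ} (hg : Submodular g)
    (hfg : ∀ S : Set V, ¬(a ∈ S ∧ b ∉ S) → f S = g S)
    (hne : cutMin s d f ≠ cutMin s d g) {S : Set V} (hs : s ∈ S) (hd : d ∉ S)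
    (hS : f S = cutMin s d f) (ha : a ∉ S) : b ∉ S := by
  intro hb
  obtain ⟨T, hsT, hdT, hT⟩ := exists_eq_cutMin hsd g
  have hgS : f S = g S := hfg S fun h => ha h.1
  have hlt : cutMin s d g < cutMin s d f :=
    lt_of_le_of_ne (by simpa [← hgS, hS] using cutMin_le g hs hd) hne.symm
  have hU : f (S ∪ T) = g (S ∪ T) := hfg _ fun h => h.2 (Or.inl hb)
  have hI : f (S ∩ T) = g (S ∩ T) := hfg _ fun h => ha h.1.1
  have hU_le : cutMin s d f ≤ f (S ∪ T) :=
    cutMin_le f (Or.inl hs) fun h => h.elim hd hdT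
  have hI_le : cutMin s d f ≤ f (S ∩ T) := cutMin_le f ⟨hs, hsT⟩ fun h => hd h.1
  linarith [hg S T]

/-- Let `v 1, …, v N` (pairwise distinct) form a directed path in a
network `G` with cut function `f`, and for `k ∈ {1, …, N-1}` let `fk k` be the cut
function of `G` with the link `(v k, v (k+1))` removed.  If the min-cut of `f` is
strictly smaller than that of `fk 1` and differs from that of every `fk k`, then every
minimizing `s`–`d` cut `S*` of `f` satisfies `v 1 ∈ S*` and `v j ∉ S*` for all
`j ∈ {2, …, N}`. -/
theorem mincut_path_propagation {V : Type*} [Fintype V]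
    (s d : V) (hsd : s ≠ d)
    (N : ℕ) (hN : 2 ≤ N) (v : ℕ → V)
    (hinj : Set.InjOn v (Set.Icc 1 N))
    (f : Set V → ℝ) (fk : ℕ → Set V → ℝ)
    (hf : Submodular f)
    (hfk : ∀ k, 1 ≤ k → k ≤ N - 1 → Submodular (fk k))
    (hffk : ∀ k, 1 ≤ k → k ≤ N - 1 →
      ∀ S : Set V, ¬(v k ∈ S ∧ v (k + 1) ∉ S) → f S = fk k S)
    (hlt : cutMin s d f < cutMin s d (fk 1))
    (hne : ∀ k, 1 ≤ k → k ≤ N - 1 → cutMin s d f ≠ cutMin s d (fk k)) :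
    ∀ S : Set V, s ∈ S → d ∉ S → f S = cutMin s d f →
      v 1 ∈ S ∧ ∀ j, 2 ≤ j → j ≤ N → v j ∉ S := by
  intro S hs hd hS
  have hfirst : v 1 ∈ S ∧ v 2 ∉ S := by
    by_contra h
    have h1 := hffk 1 le_rfl (by omega) S h
    have h2 := cutMin_le (fk 1) hs hd
    linarith
  refine ⟨hfirst.1, fun j hj => ?_⟩
  induction j, hj using Nat.le_induction with
  | base => exact fun _ => hfirst.2
  | succ k hk ih =>
    intro hkN
    exact notMem_of_cutMin_ne hsd (hfk k (by omega) (by omega)) (hffk k (by omega) (by omega))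
      (hne k (by omega) (by omega)) hs hd hS (ih (by omega))
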